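/- For each choice of sign, the operators s_i^± (i = 1,…,n−1) on V ⊗ ℂ(z_1,…,z_n,h) satisfy the Coxeter relations of the symmetric group S_n: (s_i^±)² = id, s_i^± s_j^± = s_j^± s_i^± for |i−j| > 1, and s_i^± s_{i+1}^± s_i^± = s_{i+1}^± s_i^± s_{i+1}^±. Consequently the assignments s_i ↦ s_i^± define two actions of S_n on V ⊗ ℂ(z_1,…,z_n,h), called the S_n^+- and S_n^−-actions. -/

import Mathlib

open scoped BigOperators

noncomputable section

namespace GRTV

/-- The field `ℂ(z_1,…,z_n,h)` of rational functions. -/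
abbrev K (n : ℕ) : Type := FractionRing (MvPolynomial (Fin n ⊕ Unit) ℂ)

/-- The variable `z_i`. -/
def z {n : ℕ} (i : Fin n) : K n :=
  algebraMap (MvPolynomial (Fin n ⊕ Unit) ℂ) (K n) (MvPolynomial.X (Sum.inl i))

/-- The variable `h`. -/
def hvar {n : ℕ} : K n :=
  algebraMap (MvPolynomial (Fin n ⊕ Unit) ℂ) (K n) (MvPolynomial.X (Sum.inr ()))

/-- The field automorphism of `ℂ(z_1,…,z_n,h)` permuting the variables `z_i` by `σ`
(and fixing `h`); `f ↦ f^σ`. -/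
def permK {n : ℕ} (σ : Equiv.Perm (Fin n)) : K n ≃+* K n :=
  IsFractionRing.ringEquivOfRingEquiv
    (MvPolynomial.renameEquiv ℂ (Equiv.sumCongr σ (Equiv.refl Unit))).toRingEquiv

/-- `V ⊗ ℂ(z_1,…,z_n,h)` in coordinates: a vector is the family of its coordinates
in the basis `{v_I}`, where a basis index (a decomposition `I`) is recorded as the word
`m : Fin n → Fin N` with `I_j = m⁻¹(j)`. -/
abbrev VV (n N : ℕ) : Type := (Fin n → Fin N) → K n

/-- `h` for the `+` case (`ε = true`) and `-h` for the `−` case (`ε = false`). -/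
def sign' {n : ℕ} (ε : Bool) : K n := if ε then hvar else -hvar

def fin1 {n : ℕ} (i : ℕ) (hi : i + 1 < n) : Fin n := ⟨i, Nat.lt_of_succ_lt hi⟩
def fin2 {n : ℕ} (i : ℕ) (hi : i + 1 < n) : Fin n := ⟨i + 1, hi⟩

/-- The operator `s_i^±` (`ε = true` for `+`, `ε = false` for `−`):
`s_i^± f = ((z_i−z_{i+1})P^{(i,i+1)} ∓ h)/(z_i−z_{i+1}) · f^{s_i} ± h/(z_i−z_{i+1}) · f`.
Here `P^{(i,i+1)}` acts on coordinates by precomposing the word with the transposition,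
and `f^{s_i}` applies `permK` coordinatewise. -/
def sOp {n N : ℕ} (ε : Bool) (i : ℕ) (hi : i + 1 < n) (f : VV n N) : VV n N :=
  fun m =>
    ((z (fin1 i hi) - z (fin2 i hi)) *
          permK (Equiv.swap (fin1 i hi) (fin2 i hi))
            (f (m ∘ ⇑(Equiv.swap (fin1 i hi) (fin2 i hi))))
        - sign' ε * permK (Equiv.swap (fin1 i hi) (fin2 i hi)) (f m))
      / (z (fin1 i hi) - z (fin2 i hi))
    + sign' ε / (z (fin1 i hi) - z (fin2 i hi)) * f m

section TwistedOperator

variable {F M : Type*} [Field F]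

/-- The operator `f ↦ ((a - b) P - h) / (a - b) · f^σ + h / (a - b) · f` on functions `M → F`,
where `P` is precomposition with `p` and `f^σ` applies `σ` pointwise. -/
def twistedOp (σ : F ≃+* F) (p : M → M) (a b h : F) (f : M → F) : M → F :=
  fun m => ((a - b) * σ (f (p m)) - h * σ (f m)) / (a - b) + h / (a - b) * f m

theorem twistedOp_twistedOp {σ : F ≃+* F} {p : M → M} {a b h : F}
    (hσ : ∀ x, σ (σ x) = x) (hp : ∀ m, p (p m) = m)
    (ha : σ a = b) (hb : σ b = a) (hh : σ h = h) (hab : a ≠ b) (f : M → F) :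
    twistedOp σ p a b h (twistedOp σ p a b h f) = f := by
  funext m
  have h1 : a - b ≠ 0 := sub_ne_zero.2 hab
  have h2 : b - a ≠ 0 := sub_ne_zero.2 hab.symm
  simp only [twistedOp, map_add, map_sub, map_mul, map_div₀, hσ, hp, ha, hb, hh]
  field_simp
  ring

theorem twistedOp_comm {σ τ : F ≃+* F} {p q : M → M} {a b c d h : F}
    (hστ : ∀ x, τ (σ x) = σ (τ x)) (hpq : ∀ m, q (p m) = p (q m))
    (hσc : σ c = c) (hσd : σ d = d) (hσh : σ h = h)
    (hτa : τ a = a) (hτb : τ b = b) (hτh : τ h = h)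
    (hab : a ≠ b) (hcd : c ≠ d) (f : M → F) :
    twistedOp σ p a b h (twistedOp τ q c d h f) =
      twistedOp τ q c d h (twistedOp σ p a b h f) := by
  funext m
  have h1 : a - b ≠ 0 := sub_ne_zero.2 hab
  have h2 : c - d ≠ 0 := sub_ne_zero.2 hcd
  simp only [twistedOp, map_add, map_sub, map_mul, map_div₀, hστ, hpq, hσc, hσd, hσh,
    hτa, hτb, hτh]
  field_simp
  ring

theorem twistedOp_braid {σ τ : F ≃+* F} {p q : M → M} {a b c h : F}
    (hσ : ∀ x, σ (σ x) = x) (hτ : ∀ x, τ (τ x) = x)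
    (hστ : ∀ x, τ (σ (τ x)) = σ (τ (σ x)))
    (hp : ∀ m, p (p m) = m) (hq : ∀ m, q (q m) = m)
    (hpq : ∀ m, q (p (q m)) = p (q (p m)))
    (hσa : σ a = b) (hσb : σ b = a) (hσc : σ c = c) (hσh : σ h = h)
    (hτa : τ a = a) (hτb : τ b = c) (hτc : τ c = b) (hτh : τ h = h)
    (hab : a ≠ b) (hbc : b ≠ c) (hac : a ≠ c) (f : M → F) :
    twistedOp σ p a b h (twistedOp τ q b c h (twistedOp σ p a b h f)) =
      twistedOp τ q b c h (twistedOp σ p a b h (twistedOp τ q b c h f)) := by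
  funext m
  have h1 : a - b ≠ 0 := sub_ne_zero.2 hab
  have h2 : b - a ≠ 0 := sub_ne_zero.2 hab.symm
  have h3 : b - c ≠ 0 := sub_ne_zero.2 hbc
  have h4 : c - b ≠ 0 := sub_ne_zero.2 hbc.symm
  have h5 : a - c ≠ 0 := sub_ne_zero.2 hac
  have h6 : c - a ≠ 0 := sub_ne_zero.2 hac.symm
  simp only [twistedOp, map_add, map_sub, map_mul, map_div₀, hσ, hτ, hστ, hp, hq, hpq,
    hσa, hσb, hσc, hσh, hτa, hτb, hτc, hτh]
  field_simp
  ring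

end TwistedOperator

section CoxeterPresentation

variable {G : Type*} [Group G]

/-- The first `n - 1` terms of `x` satisfy the Coxeter relations of the symmetric group `S_n`. -/
structure SatisfiesCoxeter (n : ℕ) (x : ℕ → G) : Prop where
  sq : ∀ i, i + 1 < n → x i * x i = 1
  comm : ∀ i j, j + 1 < n → i + 1 < j → x i * x j = x j * x i
  braid : ∀ i, i + 2 < n → x i * x (i + 1) * x i = x (i + 1) * x i * x (i + 1)

/-- The product `x (j + l - 1) * ⋯ * x (j + 1) * x j` of `l` factors. -/
def descProd (x : ℕ → G) (j : ℕ) : ℕ → G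
  | 0 => 1
  | l + 1 => x (j + l) * descProd x j l

theorem descProd_succ' (x : ℕ → G) (j l : ℕ) :
    descProd x j (l + 1) = descProd x (j + 1) l * x j := by
  induction l with
  | zero => simp [descProd]
  | succ l ih =>
    rw [descProd, ih, descProd, mul_assoc, show j + 1 + l = j + (l + 1) by omega]

namespace SatisfiesCoxeter

variable {n : ℕ} {x : ℕ → G}

theorem descProd_mul_of_lt (hx : SatisfiesCoxeter n x) {i j l : ℕ} (hij : i + 1 < j)
    (hl : j + l ≤ n - 1) : descProd x j l * x i = x i * descProd x j l := by
  induction l with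
  | zero => simp [descProd]
  | succ l ih =>
    rw [descProd, mul_assoc, ih (by omega), ← mul_assoc, ← mul_assoc,
      hx.comm i (j + l) (by omega) (by omega)]

theorem descProd_mul_of_ge (hx : SatisfiesCoxeter n x) {i j l : ℕ} (hi : j + l < i)
    (hin : i + 1 < n) : descProd x j l * x i = x i * descProd x j l := by
  induction l with
  | zero => simp [descProd]
  | succ l ih =>
    rw [descProd, mul_assoc, ih (by omega), ← mul_assoc, ← mul_assoc,
      hx.comm (j + l) i (by omega) (by omega)]

theorem descProd_mul_of_mem (hx : SatisfiesCoxeter n x) {i j l : ℕ} (hji : j ≤ i)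
    (hil : i + 1 < j + l) (hl : j + l ≤ n - 1) :
    descProd x j l * x (i + 1) = x i * descProd x j l := by
  induction l with
  | zero => omega
  | succ l ih =>
    rcases Nat.lt_or_ge (i + 1) (j + l) with h | h
    · rw [descProd, mul_assoc, ih h (by omega), ← mul_assoc, ← mul_assoc,
        hx.comm i (j + l) (by omega) (by omega)]
    · obtain ⟨l, rfl⟩ : ∃ k, l = k + 1 := ⟨l - 1, by omega⟩
      obtain rfl : i = j + l := by omega
      rw [descProd, descProd, ← add_assoc, mul_assoc, mul_assoc,
        hx.descProd_mul_of_ge (by omega) (by omega)]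
      simp only [← mul_assoc]
      rw [hx.braid (j + l) (by omega)]

theorem exists_eq_mul_descProd (hx : SatisfiesCoxeter n x) {k : ℕ} (hk : k + 1 < n) {g : G}
    (hg : g ∈ Subgroup.closure (x '' Set.Iio (k + 1))) :
    ∃ a ∈ Subgroup.closure (x '' Set.Iio k), ∃ j l, j + l = k + 1 ∧ g = a * descProd x j l := by
  have mul_right : ∀ i < k + 1, ∀ y : G,
      (∃ a ∈ Subgroup.closure (x '' Set.Iio k), ∃ j l, j + l = k + 1 ∧ y = a * descProd x j l) →
      ∃ a ∈ Subgroup.closure (x '' Set.Iio k), ∃ j l,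
        j + l = k + 1 ∧ y * x i = a * descProd x j l := by
    rintro i hi _ ⟨a, ha, j, l, hjl, rfl⟩
    have mem : ∀ m < k, a * x m ∈ Subgroup.closure (x '' Set.Iio k) := fun m hm =>
      mul_mem ha (Subgroup.subset_closure ⟨m, hm, rfl⟩)
    rcases Nat.lt_trichotomy i j with h | rfl | h
    · rcases Nat.lt_or_ge (i + 1) j with h' | h'
      · exact ⟨a * x i, mem i (by omega), j, l, hjl, by
          rw [mul_assoc, hx.descProd_mul_of_lt h' (by omega), mul_assoc]⟩
      · obtain rfl : j = i + 1 := by omega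
        exact ⟨a, ha, i, l + 1, by omega, by rw [descProd_succ', mul_assoc]⟩
    · obtain ⟨l, rfl⟩ : ∃ m, l = m + 1 := ⟨l - 1, by omega⟩
      exact ⟨a, ha, i + 1, l, by omega, by
        rw [descProd_succ', mul_assoc, mul_assoc, hx.sq i (by omega), mul_one]⟩
    · obtain ⟨i, rfl⟩ : ∃ m, i = m + 1 := ⟨i - 1, by omega⟩
      exact ⟨a * x i, mem i (by omega), j, l, hjl, by
        rw [mul_assoc, hx.descProd_mul_of_mem (by omega) (by omega) (by omega), mul_assoc]⟩
  induction hg using Subgroup.closure_induction_right with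
  | one => exact ⟨1, one_mem _, k + 1, 0, rfl, by simp [descProd]⟩
  | mul_right y _ s hs ih =>
    obtain ⟨i, hi, rfl⟩ := hs
    exact mul_right i hi y ih
  | mul_inv_cancel y _ s hs ih =>
    obtain ⟨i, hi, rfl⟩ := hs
    rw [inv_eq_of_mul_eq_one_left (hx.sq i (by have := Set.mem_Iio.1 hi; omega))]
    exact mul_right i hi y ih

end SatisfiesCoxeter

/-- The adjacent transposition `(i, i + 1)` of `Fin n`, or `1` when `n ≤ i + 1`. -/
def adjSwap (n i : ℕ) : Equiv.Perm (Fin n) :=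
  if hi : i + 1 < n then Equiv.swap (fin1 i hi) (fin2 i hi) else 1

theorem adjSwap_of_lt {n i : ℕ} (hi : i + 1 < n) :
    adjSwap n i = Equiv.swap (fin1 i hi) (fin2 i hi) :=
  dif_pos hi

theorem satisfiesCoxeter_adjSwap (n : ℕ) : SatisfiesCoxeter n (adjSwap n) where
  sq i hi := by simp [adjSwap_of_lt hi]
  comm i j hj hij := by
    rw [adjSwap_of_lt hj, adjSwap_of_lt (show i + 1 < n by omega)]
    refine (Equiv.Perm.disjoint_swap_swap ?_).commute
    simp [fin1, fin2]
    omega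
  braid i hi := by
    rw [adjSwap_of_lt (show i + 1 < n by omega), adjSwap_of_lt (show i + 1 + 1 < n by omega)]
    have h12 : fin1 i (show i + 1 < n by omega) ≠ fin2 i (by omega) := by simp [fin1, fin2]
    have h13 : fin1 i (show i + 1 < n by omega) ≠ fin2 (i + 1) (by omega) := by
      simp [fin1, fin2, add_assoc]
    have h23 : fin2 i (show i + 1 < n by omega) ≠ fin2 (i + 1) (by omega) := by
      simp [fin2]
    change _ = Equiv.swap (fin2 i (by omega)) _ * _ * Equiv.swap (fin2 i (by omega)) _
    rw [Equiv.swap_mul_swap_mul_swap h12 h13]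
    change Equiv.swap _ _ * Equiv.swap (fin2 i (by omega)) _ * Equiv.swap _ _ = _
    rw [Equiv.swap_comm (fin1 i _), Equiv.swap_comm (fin2 i _) (fin2 (i + 1) _),
      Equiv.swap_mul_swap_mul_swap h23.symm h13.symm,
      Equiv.swap_comm]

theorem closure_adjSwap (n : ℕ) :
    Subgroup.closure (adjSwap n '' Set.Iio (n - 1)) = ⊤ := by
  cases n with
  | zero => exact Subsingleton.elim _ _
  | succ n =>
    refine eq_top_iff.2 fun g _ => ?_
    have hg : g ∈ Submonoid.closure
        (Set.range fun i : Fin n => Equiv.swap i.castSucc i.succ) := by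
      rw [Equiv.Perm.mclosure_swap_castSucc_succ]
      trivial
    refine (Submonoid.closure_le (S := (Subgroup.closure _).toSubmonoid)).2 ?_ hg
    rintro _ ⟨i, rfl⟩
    exact Subgroup.subset_closure ⟨i, by simp, adjSwap_of_lt (by omega)⟩

theorem adjSwap_apply_of_lt {n i : ℕ} {y : Fin n} (hy : i + 1 < y) : adjSwap n i y = y := by
  rw [adjSwap_of_lt (by omega)]
  apply Equiv.swap_apply_of_ne_of_ne <;> simp [fin1, fin2, Fin.ext_iff] <;> omega

theorem descProd_adjSwap_apply {n j l : ℕ} (h : j + l < n) :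
    descProd (adjSwap n) j l ⟨j, by omega⟩ = ⟨j + l, h⟩ := by
  induction l with
  | zero => simp [descProd]
  | succ l ih =>
    rw [descProd, Equiv.Perm.mul_apply, ih (by omega), adjSwap_of_lt (i := j + l) h]
    exact Equiv.swap_apply_left _ _

theorem descProd_map {H : Type*} [Group H] (φ : G →* H) (x : ℕ → G) (j l : ℕ) :
    φ (descProd x j l) = descProd (φ ∘ x) j l := by
  induction l with
  | zero => simp [descProd]
  | succ l ih => simp [descProd, ih]

theorem eq_one_of_mem_closure_of_map_eq_one {n : ℕ} {x : ℕ → G} (hx : SatisfiesCoxeter n x)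
    (φ : G →* Equiv.Perm (Fin n)) (hφ : φ ∘ x = adjSwap n) {k : ℕ} (hk : k ≤ n - 1) {g : G}
    (hg : g ∈ Subgroup.closure (x '' Set.Iio k)) (hg1 : φ g = 1) : g = 1 := by
  induction k generalizing g with
  | zero => simpa using hg
  | succ k ih =>
    have hk' : k + 1 < n := by omega
    obtain ⟨a, ha, j, l, hjl, rfl⟩ := hx.exists_eq_mul_descProd hk' hg
    have hfix : φ a ⟨k + 1, hk'⟩ = ⟨k + 1, hk'⟩ := by
      have hle : Subgroup.closure (x '' Set.Iio k) ≤
          (MulAction.stabilizer (Equiv.Perm (Fin n)) (⟨k + 1, hk'⟩ : Fin n)).comap φ := by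
        rw [Subgroup.closure_le]
        rintro _ ⟨i, hi, rfl⟩
        have hi' : i < k := hi
        change (φ ∘ x) i _ = _
        rw [hφ]
        exact adjSwap_apply_of_lt (by simpa using hi')
      exact hle ha
    have happ : φ (a * descProd x j l) ⟨j, by omega⟩ = ⟨k + 1, hk'⟩ := by
      rw [map_mul, Equiv.Perm.mul_apply, descProd_map, hφ, descProd_adjSwap_apply (by omega)]
      simpa only [hjl] using hfix
    rw [hg1, Equiv.Perm.one_apply, Fin.mk.injEq] at happ
    obtain rfl : l = 0 := by omega
    simp only [descProd, mul_one] at hg1 ⊢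
    exact ih (by omega) ha hg1

/-- Elements of a group satisfying the Coxeter relations of `S_n` are the images of the adjacent
transpositions under a homomorphism from `S_n`. -/
theorem SatisfiesCoxeter.exists_hom {n : ℕ} {t : ℕ → G} (ht : SatisfiesCoxeter n t) :
    ∃ ρ : Equiv.Perm (Fin n) →* G, ∀ i, i + 1 < n → ρ (adjSwap n i) = t i := by
  let x : ℕ → Equiv.Perm (Fin n) × G := fun i => (adjSwap n i, t i)
  have hs := satisfiesCoxeter_adjSwap n
  have hx : SatisfiesCoxeter n x :=
    { sq := fun i hi => Prod.ext (hs.sq i hi) (ht.sq i hi)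
      comm := fun i j hj hij => Prod.ext (hs.comm i j hj hij) (ht.comm i j hj hij)
      braid := fun i hi => Prod.ext (hs.braid i hi) (ht.braid i hi) }
  let H := Subgroup.closure (x '' Set.Iio (n - 1))
  let π : H →* Equiv.Perm (Fin n) := (MonoidHom.fst _ _).comp H.subtype
  have hinj : Function.Injective π := by
    rw [injective_iff_map_eq_one]
    exact fun g hg => Subtype.ext
      (eq_one_of_mem_closure_of_map_eq_one hx (MonoidHom.fst _ _) rfl le_rfl g.2 hg)
  have hsurj : Function.Surjective π := by
    rw [← MonoidHom.range_eq_top, eq_top_iff, ← closure_adjSwap n, Subgroup.closure_le]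
    rintro _ ⟨i, hi, rfl⟩
    exact ⟨⟨x i, Subgroup.subset_closure ⟨i, hi, rfl⟩⟩, rfl⟩
  let e := MulEquiv.ofBijective π ⟨hinj, hsurj⟩
  refine ⟨((MonoidHom.snd _ _).comp H.subtype).comp e.symm.toMonoidHom, fun i hi => ?_⟩
  have he : e.symm (adjSwap n i) = ⟨x i, Subgroup.subset_closure
      ⟨i, Set.mem_Iio.2 (by omega), rfl⟩⟩ := by
    rw [MulEquiv.symm_apply_eq]
    rfl
  change (e.symm (adjSwap n i)).1.2 = t i
  rw [he]

end CoxeterPresentation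

section VariablePermutation

variable {n : ℕ}

theorem permK_algebraMap (σ : Equiv.Perm (Fin n)) (p : MvPolynomial (Fin n ⊕ Unit) ℂ) :
    permK σ (algebraMap _ (K n) p) =
      algebraMap _ (K n) (MvPolynomial.rename (Equiv.sumCongr σ (Equiv.refl Unit)) p) :=
  IsFractionRing.ringEquivOfRingEquiv_algebraMap _ _

theorem permK_z (σ : Equiv.Perm (Fin n)) (i : Fin n) : permK σ (z i) = z (σ i) := by
  simp [z, permK_algebraMap]

theorem permK_sign' (σ : Equiv.Perm (Fin n)) (ε : Bool) : permK σ (sign' ε) = sign' ε := by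
  cases ε <;> simp [sign', hvar, permK_algebraMap]

theorem permK_one (x : K n) : permK 1 x = x := by
  have h : (permK (1 : Equiv.Perm (Fin n)) : K n →+* K n) = RingHom.id _ := by
    refine IsLocalization.ringHom_ext (nonZeroDivisors (MvPolynomial (Fin n ⊕ Unit) ℂ)) ?_
    refine RingHom.ext fun p => ?_
    have : ⇑(Equiv.sumCongr (1 : Equiv.Perm (Fin n)) (Equiv.refl Unit)) = id := by
      ext (i | i) <;> rfl
    simp [permK_algebraMap, this]
  exact DFunLike.congr_fun h x

theorem permK_mul (σ τ : Equiv.Perm (Fin n)) (x : K n) :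
    permK (σ * τ) x = permK σ (permK τ x) := by
  have h : (permK (σ * τ) : K n →+* K n) = (permK σ : K n →+* K n).comp (permK τ) := by
    refine IsLocalization.ringHom_ext (nonZeroDivisors (MvPolynomial (Fin n ⊕ Unit) ℂ)) ?_
    refine RingHom.ext fun p => ?_
    have : ⇑(Equiv.sumCongr (σ * τ) (Equiv.refl Unit)) =
        Equiv.sumCongr σ (Equiv.refl Unit) ∘ Equiv.sumCongr τ (Equiv.refl Unit) := by
      ext (i | i) <;> rfl
    simp [permK_algebraMap, this, MvPolynomial.rename_rename]
  exact DFunLike.congr_fun h x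

theorem z_injective : Function.Injective (z : Fin n → K n) := fun _ _ h =>
  Sum.inl_injective (MvPolynomial.X_injective (IsFractionRing.injective _ (K n) h))

end VariablePermutation

section Relations

variable {n N : ℕ} (ε : Bool)

theorem sOp_eq_twistedOp (i : ℕ) (hi : i + 1 < n) :
    sOp (N := N) ε i hi = twistedOp (permK (adjSwap n i)) (fun m => m ∘ adjSwap n i)
      (z (fin1 i hi)) (z (fin2 i hi)) (sign' ε) := by
  rw [adjSwap_of_lt hi]
  rfl

theorem adjSwap_fin1 {i : ℕ} (hi : i + 1 < n) : adjSwap n i (fin1 i hi) = fin2 i hi := by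
  rw [adjSwap_of_lt hi, Equiv.swap_apply_left]

theorem adjSwap_fin2 {i : ℕ} (hi : i + 1 < n) : adjSwap n i (fin2 i hi) = fin1 i hi := by
  rw [adjSwap_of_lt hi, Equiv.swap_apply_right]

theorem adjSwap_apply_of_gt {i : ℕ} {y : Fin n} (hy : y.1 < i) : adjSwap n i y = y := by
  unfold adjSwap
  split_ifs with hi
  · apply Equiv.swap_apply_of_ne_of_ne <;> simp [fin1, fin2, Fin.ext_iff] <;> omega
  · rfl

theorem z_fin1_ne_z_fin2 {i : ℕ} (hi : i + 1 < n) : z (fin1 i hi) ≠ z (fin2 i hi) :=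
  z_injective.ne (by simp [fin1, fin2])

theorem sOp_sOp (i : ℕ) (hi : i + 1 < n) (f : VV n N) : sOp ε i hi (sOp ε i hi f) = f := by
  have hs := (satisfiesCoxeter_adjSwap n).sq i hi
  rw [sOp_eq_twistedOp]
  refine twistedOp_twistedOp ?_ ?_ ?_ ?_ (permK_sign' _ ε) (z_fin1_ne_z_fin2 hi) f
  · intro x
    rw [← permK_mul, hs, permK_one]
  · intro m
    rw [Function.comp_assoc, ← Equiv.Perm.coe_mul, hs]
    rfl
  · rw [permK_z, adjSwap_fin1]
  · rw [permK_z, adjSwap_fin2]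

theorem sOp_comm (i j : ℕ) (hi : i + 1 < n) (hj : j + 1 < n) (hij : i + 1 < j) (f : VV n N) :
    sOp ε i hi (sOp ε j hj f) = sOp ε j hj (sOp ε i hi f) := by
  have hs := (satisfiesCoxeter_adjSwap n).comm i j hj hij
  rw [sOp_eq_twistedOp, sOp_eq_twistedOp]
  refine twistedOp_comm ?_ ?_ ?_ ?_ (permK_sign' _ ε) ?_ ?_ (permK_sign' _ ε)
    (z_fin1_ne_z_fin2 hi) (z_fin1_ne_z_fin2 hj) f
  · intro x
    rw [← permK_mul, ← permK_mul, hs]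
  · intro m
    simp only [Function.comp_assoc, ← Equiv.Perm.coe_mul, hs]
  · rw [permK_z, adjSwap_apply_of_lt (by simpa [fin1] using hij)]
  · rw [permK_z, adjSwap_apply_of_lt (by simp [fin2]; omega)]
  · rw [permK_z, adjSwap_apply_of_gt (by simp [fin1]; omega)]
  · rw [permK_z, adjSwap_apply_of_gt (by simpa [fin2] using hij)]

theorem sOp_braid (i : ℕ) (hi : i + 1 < n) (hi2 : i + 1 + 1 < n) (f : VV n N) :
    sOp ε i hi (sOp ε (i + 1) hi2 (sOp ε i hi f)) =
      sOp ε (i + 1) hi2 (sOp ε i hi (sOp ε (i + 1) hi2 f)) := by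
  have hs := satisfiesCoxeter_adjSwap n
  have hb := hs.braid i hi2
  have hmid : fin1 (i + 1) hi2 = fin2 i hi := rfl
  have hinv : ∀ j, j + 1 < n → ∀ x : K n,
      permK (adjSwap n j) (permK (adjSwap n j) x) = x := fun j hj x => by
    rw [← permK_mul, hs.sq j hj, permK_one]
  have hinv' : ∀ j, j + 1 < n → ∀ m : Fin n → Fin N,
      (m ∘ adjSwap n j) ∘ adjSwap n j = m := fun j hj m => by
    rw [Function.comp_assoc, ← Equiv.Perm.coe_mul, hs.sq j hj]
    rfl
  rw [sOp_eq_twistedOp, sOp_eq_twistedOp, hmid]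
  refine twistedOp_braid (hinv i hi) (hinv _ hi2) ?_ (hinv' i hi) (hinv' _ hi2) ?_ ?_ ?_ ?_
    (permK_sign' _ ε) ?_ ?_ ?_ (permK_sign' _ ε) (z_fin1_ne_z_fin2 hi)
    (z_fin1_ne_z_fin2 hi2) (z_injective.ne (by simp [fin1, fin2, add_assoc])) f
  · intro x
    simp only [← permK_mul, ← mul_assoc, hb]
  · intro m
    simp only [Function.comp_assoc, ← Equiv.Perm.coe_mul, hb]
  · rw [permK_z, adjSwap_fin1]
  · rw [permK_z, adjSwap_fin2]
  · rw [permK_z, adjSwap_apply_of_lt (by simp [fin2])]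
  · rw [permK_z, adjSwap_apply_of_gt (by simp [fin1])]
  · rw [permK_z, ← hmid, adjSwap_fin1]
  · rw [permK_z, adjSwap_fin2, hmid]

/-- The operator `s_i^±` as a permutation of `V ⊗ ℂ(z_1,…,z_n,h)`, or `1` when `n ≤ i + 1`. -/
def sPerm (n N : ℕ) (ε : Bool) (i : ℕ) : Equiv.Perm (VV n N) :=
  if hi : i + 1 < n then (show Function.Involutive (sOp ε i hi) from sOp_sOp ε i hi).toPerm
  else 1

theorem sPerm_apply {i : ℕ} (hi : i + 1 < n) (f : VV n N) : sPerm n N ε i f = sOp ε i hi f := by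
  simp [sPerm, hi]

theorem satisfiesCoxeter_sPerm (n N : ℕ) (ε : Bool) : SatisfiesCoxeter n (sPerm n N ε) where
  sq i hi := Equiv.ext fun f => by
    simp only [Equiv.Perm.mul_apply, sPerm_apply ε hi, sOp_sOp, Equiv.Perm.one_apply]
  comm i j hj hij := Equiv.ext fun f => by
    have hi : i + 1 < n := by omega
    simp only [Equiv.Perm.mul_apply, sPerm_apply ε hi, sPerm_apply ε hj]
    exact sOp_comm ε i j hi hj hij f
  braid i hi2 := Equiv.ext fun f => by
    have hi : i + 1 < n := by omega
    simp only [Equiv.Perm.mul_apply, sPerm_apply ε hi, sPerm_apply ε (show i + 1 + 1 < n from hi2)]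
    exact sOp_braid ε i hi hi2 f

end Relations

/-- For each choice of sign, the operators `s_i^±` satisfy the Coxeter
relations of the symmetric group `S_n`; consequently the assignments `s_i ↦ s_i^±`
define two actions of `S_n` on `V ⊗ ℂ(z_1,…,z_n,h)` (a monoid homomorphism
`S_n →* End(V ⊗ ℂ(z,h))` sending each elementary transposition `s_i` to `s_i^±`). -/
theorem statement0 (n N : ℕ) (ε : Bool) :
    (∀ (i : ℕ) (hi : i + 1 < n) (f : VV n N), sOp ε i hi (sOp ε i hi f) = f) ∧
    (∀ (i j : ℕ) (hi : i + 1 < n) (hj : j + 1 < n), i + 1 < j →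
      ∀ f : VV n N, sOp ε i hi (sOp ε j hj f) = sOp ε j hj (sOp ε i hi f)) ∧
    (∀ (i : ℕ) (hi : i + 1 < n) (hi2 : i + 1 + 1 < n) (f : VV n N),
      sOp ε i hi (sOp ε (i+1) hi2 (sOp ε i hi f)) =
        sOp ε (i+1) hi2 (sOp ε i hi (sOp ε (i+1) hi2 f))) ∧
    (∃ ρ : Equiv.Perm (Fin n) →* Function.End (VV n N),
      ∀ (i : ℕ) (hi : i + 1 < n),
        ρ (Equiv.swap (fin1 i hi) (fin2 i hi)) = sOp ε i hi) := by
  refine ⟨sOp_sOp ε, fun i j hi hj hij => sOp_comm ε i j hi hj hij, sOp_braid ε, ?_⟩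
  obtain ⟨ρ, hρ⟩ := (satisfiesCoxeter_sPerm n N ε).exists_hom
  refine ⟨(MulAction.toEndHom (M := Equiv.Perm (VV n N))).comp ρ, fun i hi => ?_⟩
  rw [← adjSwap_of_lt hi, MonoidHom.comp_apply, hρ i hi]
  exact funext (sPerm_apply ε hi)

end GRTV
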